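/- arXiv:2306.05162 — 2 statements merged into one kernel-verified Lean document; each statement's English description precedes it below -/
import Mathlib

section
/- (Zero-forcing rate monotonicity, Lemma 2.) Let K be a positive natural number, let G be a K×K Hermitian positive definite complex matrix, let h ∈ ℂ^K, and let P > 0, σ > 0, B > 0 be real numbers. Then for every index k, B·log₂(1 + P/(σ²·Re([G⁻¹]_{kk}))) ≤ B·log₂(1 + P/(σ²·Re([(G + h·hᴴ)⁻¹]_{kk}))). In particular, if G = H_S·H_Sᴴ is the Gram matrix of the channel restricted to an active antenna set S and h is the channel column of one additional antenna, then the per-user zero-forcing rate with the enlarged antenna set is at least the rate with the original set, for every user k. -/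
open Matrix
open scoped ComplexOrder

theorem inv_diff_posSemidef {n : Type*} [Fintype n] [DecidableEq n]
    (G N : Matrix n n ℂ) (hG : G.PosDef) (hN : N.PosSemidef) :
    (G⁻¹ - (G + N)⁻¹).PosSemidef := by
  have hM : (G + N).PosDef := hG.add_posSemidef hN
  have hGu := (Matrix.isUnit_iff_isUnit_det _).1 hG.isUnit
  have hMu := (Matrix.isUnit_iff_isUnit_det _).1 hM.isUnit
  have hMi : ((G + N)⁻¹)ᴴ = (G + N)⁻¹ := hM.inv.isHermitian
  have h1 := hN.conjTranspose_mul_mul_same (G + N)⁻¹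
  have h2 := hG.inv.posSemidef.conjTranspose_mul_mul_same (N * (G + N)⁻¹)
  have h3 := h1.add h2
  rw [conjTranspose_mul, hMi, hN.isHermitian.eq] at h3
  convert h3 using 1
  have e1 : G⁻¹ - (G + N)⁻¹ = G⁻¹ * N * (G + N)⁻¹ := by
    have : G⁻¹ * N = G⁻¹ * (G + N) - 1 := by
      rw [mul_add, Matrix.nonsing_inv_mul _ hGu]; abel
    rw [this, sub_mul, mul_assoc, Matrix.mul_nonsing_inv _ hMu, mul_one, one_mul]
  have e2 : G⁻¹ = (G + N)⁻¹ * (1 + N * G⁻¹) := by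
    have : 1 + N * G⁻¹ = (G + N) * G⁻¹ := by
      rw [add_mul, Matrix.mul_nonsing_inv _ hGu]
    rw [this, ← mul_assoc, Matrix.nonsing_inv_mul _ hMu, one_mul]
  rw [e1]
  calc G⁻¹ * N * (G + N)⁻¹ = ((G + N)⁻¹ * (1 + N * G⁻¹)) * N * (G + N)⁻¹ := by rw [← e2]
    _ = _ := by noncomm_ring

/-- Zero-forcing rate monotonicity (Lemma 2): for a Hermitian positive definite Gram
matrix `G` and an additional antenna channel column `h`, the per-user zero-forcing rate
with Gram matrix `G + h hᴴ` is at least the rate with Gram matrix `G`, for every user `k`. -/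
theorem stmt_6 {K : ℕ} (hK : 0 < K)
    (G : Matrix (Fin K) (Fin K) ℂ) (hG : G.PosDef) (h : Fin K → ℂ)
    (P σ B : ℝ) (hP : 0 < P) (hσ : 0 < σ) (hB : 0 < B) :
    ∀ k : Fin K,
      B * Real.logb 2 (1 + P / (σ ^ 2 * ((G⁻¹) k k).re))
        ≤ B * Real.logb 2 (1 + P / (σ ^ 2 * (((G + vecMulVec h (star h))⁻¹) k k).re)) := by
  intro k
  have hN := posSemidef_vecMulVec_self_star h
  have hM := hG.add_posSemidef hN
  have hd := (inv_diff_posSemidef G _ hG hN).diag_nonneg (i := k)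
  have hp := hM.inv.diag_pos (i := k)
  have hp' := (Complex.lt_def.1 hp).1
  have hd' := (Complex.le_def.1 hd).1
  simp only [Matrix.sub_apply, Complex.sub_re, Complex.zero_re] at hp' hd'
  have hle : (((G + vecMulVec h (star h))⁻¹) k k).re ≤ ((G⁻¹) k k).re := by linarith
  have hp2 : 0 < ((G⁻¹) k k).re := by linarith
  apply mul_le_mul_of_nonneg_left _ hB.le
  apply Real.logb_le_logb_of_le (by norm_num) (by positivity)
  gcongr
end

section
/- (Eigen-beamforming rate monotonicity, Lemma 3.) Let N, M be positive natural numbers, let H be an N×M complex matrix, let S ⊆ A ⊆ {1, …, M} be two index sets with associated M×M diagonal 0/1 activation matrices D_S and D_A, and let λ_S and λ_A denote the largest eigenvalues of (H·D_S)ᴴ·(H·D_S) and (H·D_A)ᴴ·(H·D_A) respectively. Then for any real numbers P > 0, σ > 0, B > 0: σ²/(σ² + P·λ_S) ≥ σ²/(σ² + P·λ_A) and B·log₂(1 + P·λ_S/σ²) ≤ B·log₂(1 + P·λ_A/σ²); that is, the MMSE of Eigen-beamforming does not increase, and the per-user Eigen-beamforming rate does not decrease, when the active antenna set is enlarged. 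-/
open Matrix
open scoped ComplexOrder

/-- The `M × M` diagonal antenna activation matrix of an active antenna set `X`. -/
noncomputable def actMat (M : ℕ) (X : Finset (Fin M)) : Matrix (Fin M) (Fin M) ℂ :=
  Matrix.diagonal fun m => if m ∈ X then 1 else 0

open scoped Matrix.Norms.L2Operator MatrixOrder in
theorem lam_mono_aux {N M : ℕ} (hM : 0 < M)
    (H : Matrix (Fin N) (Fin M) ℂ) (S A : Finset (Fin M)) (hSA : S ⊆ A)
    (hS : ((H * actMat M S)ᴴ * (H * actMat M S)).IsHermitian)
    (hA : ((H * actMat M A)ᴴ * (H * actMat M A)).IsHermitian) :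
    (⨆ i : Fin M, hS.eigenvalues i) ≤ ⨆ i : Fin M, hA.eigenvalues i := by
  have : Nonempty (Fin M) := ⟨⟨0, hM⟩⟩
  have hD : actMat M S = actMat M A * actMat M S := by
    unfold actMat
    rw [Matrix.diagonal_mul_diagonal]
    congr 1
    funext m
    by_cases h : m ∈ S
    · simp [h, hSA h]
    · simp [h]
  have hDn : ‖actMat M S‖ ≤ 1 := by
    unfold actMat
    rw [Matrix.l2_opNorm_diagonal, pi_norm_le_iff_of_nonneg zero_le_one]
    intro m
    split_ifs <;> simp
  have hn : ‖H * actMat M S‖ ≤ ‖H * actMat M A‖ := by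
    rw [hD, ← Matrix.mul_assoc]
    calc _ ≤ ‖H * actMat M A‖ * ‖actMat M S‖ := Matrix.l2_opNorm_mul _ _
      _ ≤ ‖H * actMat M A‖ * 1 := by gcongr
      _ = _ := mul_one _
  have hG : ‖(H * actMat M S)ᴴ * (H * actMat M S)‖ ≤ ‖(H * actMat M A)ᴴ * (H * actMat M A)‖ := by
    rw [Matrix.l2_opNorm_conjTranspose_mul_self, Matrix.l2_opNorm_conjTranspose_mul_self]
    exact mul_self_le_mul_self (norm_nonneg _) hn
  have hmem : ‖(H * actMat M A)ᴴ * (H * actMat M A)‖ ∈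
      spectrum ℝ ((H * actMat M A)ᴴ * (H * actMat M A)) :=
    CStarAlgebra.norm_mem_spectrum_of_nonneg (A := Matrix (Fin M) (Fin M) ℂ)
      (Matrix.nonneg_iff_posSemidef.mpr (Matrix.posSemidef_conjTranspose_mul_self _))
  rw [hA.spectrum_real_eq_range_eigenvalues] at hmem
  obtain ⟨j, hj⟩ := hmem
  refine ciSup_le fun i => ?_
  have h1 := spectrum.norm_le_norm_of_mem (hS.eigenvalues_mem_spectrum_real i)
  calc hS.eigenvalues i ≤ ‖hS.eigenvalues i‖ := le_abs_self _
    _ ≤ _ := h1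
    _ ≤ _ := hG
    _ = hA.eigenvalues j := hj.symm
    _ ≤ _ := le_ciSup (Set.finite_range _).bddAbove j

/-- Eigen-beamforming rate monotonicity (Lemma 3): enlarging the active antenna set
`S ⊆ A` does not increase the single-stream Eigen-beamforming MMSE `σ²/(σ² + Pλ)` and
does not decrease the per-user Eigen-beamforming rate `B log₂(1 + Pλ/σ²)`, where `λ_S`
and `λ_A` are the largest eigenvalues of `(H D_S)ᴴ (H D_S)` and `(H D_A)ᴴ (H D_A)`. -/
theorem stmt_11 {N M : ℕ} (hN : 0 < N) (hM : 0 < M)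
    (H : Matrix (Fin N) (Fin M) ℂ) (S A : Finset (Fin M)) (hSA : S ⊆ A)
    (hS : ((H * actMat M S)ᴴ * (H * actMat M S)).IsHermitian)
    (hA : ((H * actMat M A)ᴴ * (H * actMat M A)).IsHermitian)
    (lamS lamA : ℝ)
    (hlamS : lamS = ⨆ i : Fin M, hS.eigenvalues i)
    (hlamA : lamA = ⨆ i : Fin M, hA.eigenvalues i)
    (P σ B : ℝ) (hP : 0 < P) (hσ : 0 < σ) (hB : 0 < B) :
    σ ^ 2 / (σ ^ 2 + P * lamS) ≥ σ ^ 2 / (σ ^ 2 + P * lamA) ∧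
    B * Real.logb 2 (1 + P * lamS / σ ^ 2) ≤ B * Real.logb 2 (1 + P * lamA / σ ^ 2) := by
  have hle : lamS ≤ lamA := by
    rw [hlamS, hlamA]
    exact lam_mono_aux hM H S A hSA hS hA
  have h0 : 0 ≤ lamS := by
    rw [hlamS]
    exact Real.iSup_nonneg fun i =>
      (Matrix.posSemidef_conjTranspose_mul_self (H * actMat M S)).eigenvalues_nonneg i
  have hσ2 : 0 < σ ^ 2 := by positivity
  constructor
  · show σ ^ 2 / (σ ^ 2 + P * lamA) ≤ σ ^ 2 / (σ ^ 2 + P * lamS)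
    gcongr
  · refine mul_le_mul_of_nonneg_left ?_ hB.le
    refine Real.logb_le_logb_of_le (by norm_num) (by positivity) ?_
    gcongr
end
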